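/- Let φ(x) = e^{-2|x|}, with Fourier transform φ̂(ξ) = 4/(√(2π)(ξ²+4)), and let (α_j)_{j≥1} be positive reals with ∑_{j=1}^∞ α_j e^{4j} < ∞. For each j, define (W(-j)φ)(x) := (2π)^{-1/2} ∫_ℝ e^{ixξ} e^{ijξ⁵} φ̂(ξ) dξ (an absolutely convergent integral). Then the series u₀(x) := ∑_{j=1}^∞ α_j (W(-j)φ)(x) converges for every x ∈ ℝ, and u₀ is infinitely differentiable (C^∞) on ℝ. -/

import Mathlib

open MeasureTheory
open scoped Real

/-- The Fourier transform of `φ(x) = e^{-2|x|}`: `φ̂(ξ) = 4/(√(2π)(ξ²+4))`. -/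
noncomputable def phiHat (ξ : ℝ) : ℂ :=
  ((4 / (Real.sqrt (2 * π) * (ξ ^ 2 + 4)) : ℝ) : ℂ)

/-- `(W(-j)φ)(x) = (2π)^{-1/2} ∫ e^{ixξ} e^{ijξ⁵} φ̂(ξ) dξ`. -/
noncomputable def Wminus (j : ℕ) (x : ℝ) : ℂ :=
  (Real.sqrt (2 * π) : ℂ)⁻¹ *
    ∫ ξ : ℝ, Complex.exp (Complex.I * x * ξ) * Complex.exp (Complex.I * (j : ℝ) * ξ ^ 5) * phiHat ξ

/-- The meromorphic extension of `phiHat`. -/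
noncomputable def phiC (z : ℂ) : ℂ := 4 / ((Real.sqrt (2 * π) : ℂ) * (z ^ 2 + 4))

/-- The integrand of `Wminus`, extended to complex frequencies. -/
noncomputable def FC (j : ℕ) (x : ℝ) (z : ℂ) : ℂ :=
  Complex.exp (Complex.I * x * z) * Complex.exp (Complex.I * (j : ℝ) * z ^ 5) * phiC z

lemma sqrt_two_pi_ge_one : 1 ≤ Real.sqrt (2 * π) := by
  rw [Real.one_le_sqrt]
  nlinarith [Real.pi_gt_three]

lemma re_sq_add (s η : ℝ) :
    (((s : ℂ) + η * Complex.I) ^ 2 + 4).re = s ^ 2 - η ^ 2 + 4 := by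
  have : ((s : ℂ) + η * Complex.I) ^ 2 + 4
      = ((s ^ 2 - η ^ 2 + 4 : ℝ) : ℂ) + ((2 * s * η : ℝ) : ℂ) * Complex.I := by
    push_cast
    linear_combination (η : ℂ) ^ 2 * Complex.I_sq
  rw [this]
  simp only [Complex.add_re, Complex.ofReal_re, Complex.re_ofReal_mul, Complex.I_re]
  ring

lemma norm_phiC_le (s η : ℝ) (h0 : 0 ≤ η) (h1 : η ≤ 1) :
    ‖phiC (s + η * Complex.I)‖ ≤ 4 * (1 + s ^ 2)⁻¹ := by
  have hre : 1 + s ^ 2 ≤ ‖((s : ℂ) + η * Complex.I) ^ 2 + 4‖ := by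
    refine le_trans ?_ (Complex.re_le_norm _)
    rw [re_sq_add]
    nlinarith
  have hp : 0 < 1 + s ^ 2 := by positivity
  unfold phiC
  rw [norm_div, norm_mul, Complex.norm_real, Real.norm_of_nonneg (Real.sqrt_nonneg _), div_eq_mul_inv]
  have h4 : ‖(4 : ℂ)‖ = 4 := by simp
  rw [h4]
  gcongr
  nlinarith [sqrt_two_pi_ge_one]

lemma norm_expx (x s η : ℝ) :
    ‖Complex.exp (Complex.I * x * (s + η * Complex.I))‖ = Real.exp (-(x * η)) := by
  rw [Complex.norm_exp]
  congr 1
  simp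

lemma norm_exp5 (j : ℕ) (s η : ℝ) :
    ‖Complex.exp (Complex.I * (j : ℝ) * ((s : ℂ) + η * Complex.I) ^ 5)‖
      = Real.exp (j * (4 * η ^ 5 - 5 * η * (s ^ 2 - η ^ 2) ^ 2)) := by
  rw [Complex.norm_exp]
  congr 1
  have : Complex.I * (j : ℝ) * ((s : ℂ) + η * Complex.I) ^ 5
      = ((j * (4 * η ^ 5 - 5 * η * (s ^ 2 - η ^ 2) ^ 2) : ℝ) : ℂ)
        + ((j * (s ^ 5 - 10 * s ^ 3 * η ^ 2 + 5 * s * η ^ 4) : ℝ) : ℂ) * Complex.I := by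
    have h2 := Complex.I_sq
    have h3 : Complex.I ^ 3 = - Complex.I := Complex.I_pow_three
    have h4 : Complex.I ^ 4 = 1 := Complex.I_pow_four
    have h5 : Complex.I ^ 5 = Complex.I := by rw [pow_succ, h4, one_mul]
    have h6 : Complex.I ^ 6 = -1 := by rw [pow_succ, h5, Complex.I_mul_I]
    push_cast
    ring_nf
    rw [h2, h3, h4, h5, h6]
    ring
  rw [this]
  simp only [Complex.add_re, Complex.ofReal_re, Complex.re_ofReal_mul, Complex.I_re]
  ring

lemma norm_exp5_le (j : ℕ) (s η : ℝ) (h0 : 0 ≤ η) (h1 : η ≤ 1) :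
    ‖Complex.exp (Complex.I * (j : ℝ) * ((s : ℂ) + η * Complex.I) ^ 5)‖
      ≤ Real.exp (4 * j) := by
  rw [norm_exp5]
  apply Real.exp_le_exp.2
  have h5 : η ^ 5 ≤ 1 := pow_le_one₀ h0 h1
  have h6 : 0 ≤ 5 * η * (s ^ 2 - η ^ 2) ^ 2 := by positivity
  have hj : (0 : ℝ) ≤ j := by positivity
  nlinarith

lemma norm_exp5_top (j : ℕ) (s : ℝ) :
    ‖Complex.exp (Complex.I * ((j + 1 : ℕ) : ℝ) * ((s : ℂ) + Complex.I) ^ 5)‖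
      ≤ Real.exp (4 * (j + 1)) * Real.exp (2 - s ^ 2) := by
  have h := norm_exp5 (j + 1) s 1
  rw [Complex.ofReal_one, one_mul] at h
  rw [h, ← Real.exp_add]
  apply Real.exp_le_exp.2
  push_cast
  have hj : (0 : ℝ) ≤ j := by positivity
  nlinarith [mul_nonneg hj (sq_nonneg (s ^ 2 - 1)), sq_nonneg (s ^ 2 - 11 / 10)]

lemma norm_FC_le (j : ℕ) (x s η : ℝ) (h0 : 0 ≤ η) (h1 : η ≤ 1) :
    ‖FC j x (s + η * Complex.I)‖
      ≤ (Real.exp |x| * Real.exp (4 * j) * 4) * (1 + s ^ 2)⁻¹ := by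
  unfold FC
  rw [norm_mul, norm_mul, norm_expx, mul_assoc _ (4 : ℝ)]
  gcongr
  · nlinarith [neg_abs_le x, abs_nonneg x]
  · exact norm_exp5_le j s η h0 h1
  · exact norm_phiC_le s η h0 h1

lemma den_ne (s η : ℝ) (h0 : 0 ≤ η) (h1 : η ≤ 1) :
    (Real.sqrt (2 * π) : ℂ) * (((s : ℂ) + η * Complex.I) ^ 2 + 4) ≠ 0 := by
  apply mul_ne_zero
  · have := sqrt_two_pi_ge_one
    exact Complex.ofReal_ne_zero.2 (by positivity)
  · intro h
    have h2 := re_sq_add s η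
    rw [h] at h2
    simp only [Complex.zero_re] at h2
    nlinarith

lemma differentiableAt_FC (j : ℕ) (x s η : ℝ) (h0 : 0 ≤ η) (h1 : η ≤ 1) :
    DifferentiableAt ℂ (FC j x) (s + η * Complex.I) := by
  unfold FC phiC
  have := den_ne s η h0 h1
  fun_prop (disch := assumption)

lemma integrable_FC (j : ℕ) (x η : ℝ) (h0 : 0 ≤ η) (h1 : η ≤ 1) :
    Integrable (fun s : ℝ => FC j x (s + η * Complex.I)) := by
  refine Integrable.mono' (integrable_inv_one_add_sq.const_mul
    (Real.exp |x| * Real.exp (4 * j) * 4)) ?_ (Filter.Eventually.of_forall fun s =>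
      norm_FC_le j x s η h0 h1)
  apply Continuous.aestronglyMeasurable
  rw [continuous_iff_continuousAt]
  intro s
  exact ContinuousAt.comp (g := FC j x) (f := fun s : ℝ => (s : ℂ) + η * Complex.I)
    (differentiableAt_FC j x s η h0 h1).continuousAt (by fun_prop)

lemma vert_tendsto (j : ℕ) (x : ℝ) (g : ℝ → ℝ) (hg : ∀ T, g T ^ 2 = T ^ 2) :
    Filter.Tendsto (fun T : ℝ => ∫ y : ℝ in (0 : ℝ)..1, FC j x (g T + y * Complex.I))
      Filter.atTop (nhds 0) := by
  have hlim : Filter.Tendsto (fun T : ℝ =>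
      (Real.exp |x| * Real.exp (4 * j) * 4) * (1 + T ^ 2)⁻¹) Filter.atTop (nhds 0) := by
    rw [← mul_zero (Real.exp |x| * Real.exp (4 * j) * 4)]
    apply Filter.Tendsto.const_mul
    apply Filter.Tendsto.inv_tendsto_atTop
    exact Filter.tendsto_atTop_add_const_left _ _ (Filter.tendsto_pow_atTop (by norm_num))
  refine squeeze_zero_norm (fun T => ?_) hlim
  have := intervalIntegral.norm_integral_le_of_norm_le_const (a := 0) (b := 1)
    (f := fun y : ℝ => FC j x (g T + y * Complex.I))
    (C := (Real.exp |x| * Real.exp (4 * j) * 4) * (1 + T ^ 2)⁻¹) ?_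
  · simpa using this
  · intro y hy
    rw [Set.uIoc_of_le zero_le_one] at hy
    rw [← hg T]
    exact norm_FC_le j x (g T) y hy.1.le hy.2

lemma shift (j : ℕ) (x : ℝ) :
    ∫ s : ℝ, FC j x s = ∫ s : ℝ, FC j x (s + Complex.I) := by
  have i0 := integrable_FC j x 0 le_rfl zero_le_one
  have i1 := integrable_FC j x 1 zero_le_one le_rfl
  have t0 := intervalIntegral_tendsto_integral i0 Filter.tendsto_neg_atTop_atBot Filter.tendsto_id
  have t1 := intervalIntegral_tendsto_integral i1 Filter.tendsto_neg_atTop_atBot Filter.tendsto_id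
  have v1 := (vert_tendsto j x (fun T => T) (fun T => rfl)).const_smul Complex.I
  have v2 := (vert_tendsto j x (fun T => -T) (fun T => by ring)).const_smul Complex.I
  have key := ((t0.sub t1).add v1).sub v2
  have hz : ∀ T : ℝ, (∫ s : ℝ in (-T)..T, FC j x (s + (0 : ℝ) * Complex.I))
      - (∫ s : ℝ in (-T)..T, FC j x (s + (1 : ℝ) * Complex.I))
      + Complex.I • (∫ y : ℝ in (0 : ℝ)..1, FC j x (T + y * Complex.I))
      - Complex.I • (∫ y : ℝ in (0 : ℝ)..1, FC j x ((-T : ℝ) + y * Complex.I)) = 0 := by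
    intro T
    have := Complex.integral_boundary_rect_eq_zero_of_differentiableOn (FC j x)
      ⟨-T, 0⟩ ⟨T, 1⟩ ?_
    · exact this
    · intro z hz
      have h2 := hz.2
      simp only [Set.mem_preimage, Set.uIcc_of_le zero_le_one] at h2
      have := differentiableAt_FC j x z.re z.im h2.1 h2.2
      rw [Complex.re_add_im] at this
      exact this.differentiableWithinAt
  have h0 := tendsto_nhds_unique (key.congr (f₂ := fun _ => (0 : ℂ)) hz) tendsto_const_nhds
  simp only [smul_zero, add_zero, sub_zero, Complex.ofReal_zero, zero_mul, Complex.ofReal_one,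
    one_mul] at h0
  exact sub_eq_zero.1 h0

lemma Wminus_eq (j : ℕ) (x : ℝ) :
    Wminus j x = (Real.sqrt (2 * π) : ℂ)⁻¹ * ∫ s : ℝ, FC j x (s + Complex.I) := by
  rw [← shift]
  unfold Wminus FC phiHat phiC
  push_cast
  rfl

/-- The summed symbol on the shifted line. -/
noncomputable def GC (α : ℕ → ℝ) (s : ℝ) : ℂ :=
  phiC (s + Complex.I) *
    ∑' j : ℕ, (α j : ℂ) * Complex.exp (Complex.I * ((j + 1 : ℕ) : ℝ) * ((s : ℂ) + Complex.I) ^ 5)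

lemma norm_phiC_top (s : ℝ) : ‖phiC (s + Complex.I)‖ ≤ 4 := by
  have := norm_phiC_le s 1 zero_le_one le_rfl
  rw [Complex.ofReal_one, one_mul] at this
  refine this.trans ?_
  have : (1 + s ^ 2)⁻¹ ≤ 1 := inv_le_one_of_one_le₀ (by nlinarith [sq_nonneg s])
  linarith

lemma continuous_phiC_top : Continuous (fun s : ℝ => phiC (s + Complex.I)) := by
  have h : ∀ s : ℝ, (Real.sqrt (2 * π) : ℂ) * (((s : ℂ) + Complex.I) ^ 2 + 4) ≠ 0 := by
    intro s
    have := den_ne s 1 zero_le_one le_rfl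
    rwa [Complex.ofReal_one, one_mul] at this
  unfold phiC
  exact Continuous.div (by fun_prop) (by fun_prop) h

section main
variable (α : ℕ → ℝ)

lemma term_bound (hpos : ∀ j : ℕ, 0 < α j) (j : ℕ) (s : ℝ) :
    ‖(α j : ℂ) * Complex.exp (Complex.I * ((j + 1 : ℕ) : ℝ) * ((s : ℂ) + Complex.I) ^ 5)‖
      ≤ α j * Real.exp (4 * (j + 1)) * Real.exp (2 - s ^ 2) := by
  rw [norm_mul, Complex.norm_real, Real.norm_of_nonneg (hpos j).le, mul_assoc (α j)]
  exact mul_le_mul_of_nonneg_left (norm_exp5_top j s) (hpos j).le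

lemma continuous_GC (hpos : ∀ j : ℕ, 0 < α j)
    (hsum : Summable fun j : ℕ => α j * Real.exp (4 * (j + 1))) : Continuous (GC α) := by
  unfold GC
  refine continuous_phiC_top.mul (continuous_tsum (u := fun j : ℕ =>
    α j * Real.exp (4 * (j + 1)) * Real.exp 2) (fun j => by fun_prop) (hsum.mul_right _) ?_)
  intro j s
  refine (term_bound α hpos j s).trans ?_
  have := (hpos j).le
  gcongr
  nlinarith [sq_nonneg s]

lemma norm_GC_le (hpos : ∀ j : ℕ, 0 < α j)
    (hsum : Summable fun j : ℕ => α j * Real.exp (4 * (j + 1))) (s : ℝ) :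
    ‖GC α s‖ ≤ 4 * ((∑' j : ℕ, α j * Real.exp (4 * (j + 1))) * Real.exp (2 - s ^ 2)) := by
  unfold GC
  rw [norm_mul]
  refine mul_le_mul (norm_phiC_top s) ?_ (norm_nonneg _) (by norm_num)
  exact tsum_of_norm_bounded (hsum.hasSum.mul_right _) (fun j => term_bound α hpos j s)

lemma integrable_pow_GC (hpos : ∀ j : ℕ, 0 < α j)
    (hsum : Summable fun j : ℕ => α j * Real.exp (4 * (j + 1))) (n : ℕ) :
    Integrable (fun s : ℝ => ‖s‖ ^ n * ‖GC α s‖) := by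
  have hn : (-1 : ℝ) < n := by
    have : (0 : ℝ) ≤ n := by positivity
    linarith
  have h := ((integrable_rpow_mul_exp_neg_mul_sq zero_lt_one hn).norm).const_mul
    (4 * (∑' j : ℕ, α j * Real.exp (4 * (j + 1))) * Real.exp 2)
  refine h.mono' ?_ (Filter.Eventually.of_forall fun s => ?_)
  · have := continuous_GC α hpos hsum
    exact Continuous.aestronglyMeasurable (by fun_prop)
  · rw [norm_mul, norm_norm, norm_pow, norm_norm, norm_mul, Real.rpow_natCast, norm_pow,
      Real.norm_of_nonneg (Real.exp_pos _).le]
    calc ‖s‖ ^ n * ‖GC α s‖ ≤ ‖s‖ ^ n *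
          (4 * ((∑' j : ℕ, α j * Real.exp (4 * (j + 1))) * Real.exp (2 - s ^ 2))) := by
          gcongr
          exact norm_GC_le α hpos hsum s
      _ = _ := by
          rw [show 2 - s ^ 2 = 2 + -1 * s ^ 2 by ring, Real.exp_add]
          ring

lemma hasSum_W (hpos : ∀ j : ℕ, 0 < α j)
    (hsum : Summable fun j : ℕ => α j * Real.exp (4 * (j + 1))) (x : ℝ) :
    HasSum (fun j : ℕ => (α j : ℂ) * Wminus (j + 1) x)
      ((Real.sqrt (2 * π) : ℂ)⁻¹ *
        ∫ s : ℝ, Complex.exp (Complex.I * x * (s + Complex.I)) * GC α s) := by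
  have hInt : ∀ j : ℕ, Integrable (fun s : ℝ => (α j : ℂ) * FC (j + 1) x (s + Complex.I)) := by
    intro j
    have := integrable_FC (j + 1) x 1 zero_le_one le_rfl
    simp only [Complex.ofReal_one, one_mul] at this
    exact this.const_mul _
  have hgauss : Integrable (fun s : ℝ => Real.exp (2 - s ^ 2)) := by
    have := (integrable_exp_neg_mul_sq (b := 1) zero_lt_one).const_mul (Real.exp 2)
    refine this.congr (Filter.Eventually.of_forall fun s => ?_)
    simp only
    rw [← Real.exp_add]
    congr 1
    ring
  have hb : ∀ (j : ℕ) (s : ℝ), ‖(α j : ℂ) * FC (j + 1) x (s + Complex.I)‖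
      ≤ (α j * Real.exp (4 * (j + 1))) * (Real.exp (-x) * 4 * Real.exp (2 - s ^ 2)) := by
    intro j s
    have h1 := term_bound α hpos j s
    have h2 := norm_expx x s 1
    rw [Complex.ofReal_one, one_mul, mul_one] at h2
    calc ‖(α j : ℂ) * FC (j + 1) x (s + Complex.I)‖
        = Real.exp (-x) * ‖(α j : ℂ) * Complex.exp (Complex.I * ((j + 1 : ℕ) : ℝ) *
            ((s : ℂ) + Complex.I) ^ 5)‖ * ‖phiC (s + Complex.I)‖ := by
          rw [← h2, ← norm_mul, ← norm_mul]
          unfold FC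
          congr 1
          ring
      _ ≤ Real.exp (-x) * (α j * Real.exp (4 * (j + 1)) * Real.exp (2 - s ^ 2)) * 4 := by
          have := norm_phiC_top s
          have := (hpos j).le
          gcongr
      _ = _ := by ring
  have hs := hasSum_integral_of_summable_integral_norm hInt ?_
  · have hs2 := hs.mul_left (Real.sqrt (2 * π) : ℂ)⁻¹
    convert hs2 using 1
    · rfl
    · funext j
      rw [Wminus_eq, integral_const_mul]
      ring
    · congr 2
      funext s
      unfold GC FC
      rw [← mul_assoc, ← tsum_mul_left]
      congr 1
      funext j
      ring
  · refine Summable.of_nonneg_of_le (fun j => integral_nonneg fun s => norm_nonneg _)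
      (fun j => ?_) (hsum.mul_right (∫ s : ℝ, Real.exp (-x) * 4 * Real.exp (2 - s ^ 2)))
    rw [← integral_const_mul]
    exact integral_mono (hInt j).norm ((hgauss.const_mul _).const_mul _) (hb j)

end main

theorem stmt17 (α : ℕ → ℝ) (hpos : ∀ j : ℕ, 0 < α j)
    (hsum : Summable fun j : ℕ => α j * Real.exp (4 * (j + 1))) :
    (∀ x : ℝ, Summable fun j : ℕ => (α j : ℂ) * Wminus (j + 1) x) ∧
      ContDiff ℝ (⊤ : ℕ∞) (fun x : ℝ => ∑' j : ℕ, (α j : ℂ) * Wminus (j + 1) x) := by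
  refine ⟨fun x => (hasSum_W α hpos hsum x).summable, ?_⟩
  have hF : ContDiff ℝ (⊤ : ℕ∞) (FourierTransform.fourier (GC α) : ℝ → ℂ) :=
    Real.contDiff_fourier (N := ⊤) (fun n _ => integrable_pow_GC α hpos hsum n)
  have heq : (fun x : ℝ => ∑' j : ℕ, (α j : ℂ) * Wminus (j + 1) x) = fun x : ℝ =>
      (Real.sqrt (2 * π) : ℂ)⁻¹ * (((Real.exp (-x) : ℝ) : ℂ) *
        (FourierTransform.fourier (GC α) : ℝ → ℂ) (-(2 * π)⁻¹ * x)) := by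
    funext x
    rw [(hasSum_W α hpos hsum x).tsum_eq, Real.fourier_real_eq_integral_exp_smul,
      ← integral_const_mul (((Real.exp (-x) : ℝ) : ℂ))]
    congr 2
    funext s
    rw [smul_eq_mul, ← mul_assoc, Complex.ofReal_exp, ← Complex.exp_add]
    congr 2
    have hpi : -2 * π * s * (-(2 * π)⁻¹ * x) = s * x := by
      field_simp
    rw [hpi]
    push_cast
    linear_combination (x : ℂ) * Complex.I_sq
  rw [heq]
  refine contDiff_const.mul (ContDiff.mul ?_ (hF.comp (by fun_prop)))
  exact Complex.ofRealCLM.contDiff.comp (Real.contDiff_exp.comp contDiff_neg)
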